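/- Let B be a standard Brownian motion on [0,1], c ∈ ℝ, and B^c_t := B_t + (3/2) t(2−t)(c − ∫₀¹ B). Define S_t := B_t for t ∈ [0,1/2] and S_t := B_t + (12 t(2−t) − 9)(c − ∫₀¹ B) for t ∈ [1/2,1], and ρ(ω) := √8 · exp( −12 ( ∫₀^{1/2} (ω_r + ω_{1/2}) dr − c )² + (3/2) c² ) for ω ∈ C([0,1]). Then for every bounded Borel Φ : C([0,1]) → ℝ, E[Φ(B^c)] = E[Φ(S) ρ(S)]. -/

import Mathlib

open MeasureTheory ProbabilityTheory Set

/-- `B` is a standard Brownian motion on `[0,1]`: a centered Gaussian process with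
continuous paths and covariance `E[B_s B_t] = min s t`. -/
def IsBrownianMotion {Ω : Type*} [MeasurableSpace Ω] (P : Measure Ω)
    (B : ℝ → Ω → ℝ) : Prop :=
  (∀ t, Measurable (B t)) ∧
  (∀ ω, ContinuousOn (fun t => B t ω) (Icc 0 1)) ∧
  (∀ (n : ℕ) (t : Fin n → ℝ), (∀ i, t i ∈ Icc (0:ℝ) 1) → ∀ c : Fin n → ℝ,
    ∃ v : NNReal,
      Measure.map (fun ω => ∑ i, c i * B (t i) ω) P = gaussianReal 0 v) ∧
  (∀ s ∈ Icc (0:ℝ) 1, ∀ t ∈ Icc (0:ℝ) 1, ∫ ω, B s ω * B t ω ∂P = min s t)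

namespace IsBrownianMotion

variable {Ω : Type*} [MeasurableSpace Ω] {P : Measure Ω} {B : ℝ → Ω → ℝ}

lemma exists_hasLaw_sum (hB : IsBrownianMotion P B) {κ : Type*} [Fintype κ] {t : κ → ℝ}
    (ht : ∀ k, t k ∈ Icc (0 : ℝ) 1) (a : κ → ℝ) :
    ∃ v : NNReal, HasLaw (fun ω => ∑ k, a k * B (t k) ω) (gaussianReal 0 v) P := by
  obtain ⟨v, hv⟩ := hB.2.2.1 (Fintype.card κ) (t ∘ (Fintype.equivFin κ).symm) (fun i => ht _)
    (a ∘ (Fintype.equivFin κ).symm)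
  refine ⟨v, (Finset.measurable_fun_sum _ fun k _ => (hB.1 _).const_mul _).aemeasurable, ?_⟩
  rw [← hv]
  congr 1
  ext ω
  exact ((Fintype.equivFin κ).symm.sum_comp fun k => a k * B (t k) ω).symm

lemma memLp_two (hB : IsBrownianMotion P B) {t : ℝ} (ht : t ∈ Icc (0 : ℝ) 1) :
    MemLp (B t) 2 P := by
  obtain ⟨v, hv⟩ := hB.exists_hasLaw_sum (κ := Unit) (t := fun _ => t) (fun _ => ht) 1
  have h : HasLaw (B t) (gaussianReal 0 v) P := by simpa using hv
  have h2 : HasGaussianLaw (B t) P := h.hasGaussianLaw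
  exact h2.memLp_two

lemma integral_cexp_sum (hB : IsBrownianMotion P B) {κ : Type*} [Fintype κ] {t : κ → ℝ}
    (ht : ∀ k, t k ∈ Icc (0 : ℝ) 1) (a : κ → ℝ) :
    ∫ ω, Complex.exp (Complex.I * ((∑ k, a k * B (t k) ω : ℝ) : ℂ)) ∂P
      = Complex.exp ((-(1 / 2) * ∑ k, ∑ l, a k * a l * min (t k) (t l) : ℝ) : ℂ) := by
  obtain ⟨v, hv⟩ := hB.exists_hasLaw_sum ht a
  have hvar : (v : ℝ) = ∑ k, ∑ l, a k * a l * min (t k) (t l) := by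
    have h1 : ∫ ω, (∑ k, a k * B (t k) ω) ^ 2 ∂P = v := by
      refine (hv.integral_comp (f := fun x : ℝ => x ^ 2) (by fun_prop)).trans ?_
      have := variance_id_gaussianReal (μ := 0) (v := v)
      rw [variance_eq_integral (by fun_prop)] at this
      simpa using this
    have hint : ∀ k l, Integrable (fun ω => a k * a l * (B (t k) ω * B (t l) ω)) P := fun k l =>
      ((hB.memLp_two (ht k)).integrable_mul (hB.memLp_two (ht l))).const_mul _
    have h2 : ∀ ω, (∑ k, a k * B (t k) ω) ^ 2
        = ∑ k, ∑ l, a k * a l * (B (t k) ω * B (t l) ω) := fun ω => by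
      rw [sq, Finset.sum_mul_sum]
      exact Finset.sum_congr rfl fun k _ => Finset.sum_congr rfl fun l _ => by ring
    rw [← h1, integral_congr_ae (.of_forall h2),
      integral_finsetSum _ fun k _ => integrable_finsetSum _ fun l _ => hint k l]
    refine Finset.sum_congr rfl fun k _ => ?_
    rw [integral_finsetSum _ fun l _ => hint k l]
    refine Finset.sum_congr rfl fun l _ => ?_
    rw [integral_const_mul, hB.2.2.2 _ (ht k) _ (ht l)]
  have h3 := charFun_gaussianReal (μ := 0) (v := v) 1
  rw [charFun_apply_real,
    ← hv.integral_comp (f := fun x : ℝ => Complex.exp ((1 : ℝ) * x * Complex.I)) (by fun_prop)] at h3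
  rw [← hvar]
  convert h3 using 3
  · simp [mul_comm]
  · push_cast; ring

end IsBrownianMotion

lemma abs_riemannSum_sub_integral_le {f : ℝ → ℝ} (hf : ContinuousOn f (Icc 0 1)) {n : ℕ}
    (hn : n ≠ 0) {ε : ℝ} (h : ∀ x ∈ Icc (0 : ℝ) 1, ∀ y ∈ Icc (0 : ℝ) 1, |x - y| ≤ 1 / n →
      |f x - f y| ≤ ε) :
    |∑ j : Fin n, (1 / n : ℝ) * f (j / n) - ∫ x in (0 : ℝ)..1, f x| ≤ ε := by
  have hn0 : (0 : ℝ) < n := by positivity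
  have hmem : ∀ j ≤ n, (j / n : ℝ) ∈ Icc (0 : ℝ) 1 := fun j hj =>
    ⟨by positivity, div_le_one_of_le₀ (by exact_mod_cast hj) hn0.le⟩
  have hsub : ∀ j < n, Icc (j / n : ℝ) ((j + 1 : ℕ) / n) ⊆ Icc (0 : ℝ) 1 := fun j hj =>
    Icc_subset_Icc (hmem j hj.le).1 (hmem (j + 1) hj).2
  have hle : ∀ j : ℕ, (j / n : ℝ) ≤ (j + 1 : ℕ) / n := fun j => by gcongr; simp
  have hint : ∀ j < n, IntervalIntegrable f volume (j / n : ℝ) ((j + 1 : ℕ) / n) := fun j hj =>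
    (hf.mono (by rw [uIcc_of_le (hle j)]; exact hsub j hj)).intervalIntegrable
  have hsum := intervalIntegral.sum_integral_adjacent_intervals
    (a := fun j : ℕ => (j / n : ℝ)) (n := n) hint
  simp only [Nat.cast_zero, zero_div, div_self hn0.ne'] at hsum
  rw [← hsum, ← Fin.sum_univ_eq_sum_range
    (fun j => ∫ x in (j / n : ℝ)..((j + 1 : ℕ) / n), f x), ← Finset.sum_sub_distrib]
  refine (Finset.abs_sum_le_sum_abs _ _).trans ?_
  have hterm : ∀ j : Fin n,
      |(1 / n : ℝ) * f (j / n) - ∫ x in (j / n : ℝ)..((j + 1 : ℕ) / n), f x| ≤ ε * (1 / n) := by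
    intro j
    have hlen : ((j + 1 : ℕ) / n : ℝ) - j / n = 1 / n := by push_cast; ring
    have hc : (1 / n : ℝ) * f (j / n) = ∫ _ in (j / n : ℝ)..((j + 1 : ℕ) / n), f (j / n) := by
      rw [intervalIntegral.integral_const, hlen, smul_eq_mul]
    rw [hc, ← intervalIntegral.integral_sub (by simp) (hint j j.2)]
    rw [show ε * (1 / n) = ε * |((j + 1 : ℕ) / n : ℝ) - j / n| by
      rw [hlen, abs_of_pos (by positivity)]]
    refine intervalIntegral.norm_integral_le_of_norm_le_const
      (f := fun x => f (j / n) - f x) fun x hx => ?_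
    rw [uIoc_of_le (hle j)] at hx
    refine h _ (hmem _ j.2.le) _ (hsub j j.2 (Ioc_subset_Icc_self hx)) ?_
    rw [abs_le]
    constructor <;> linarith [hx.1, hx.2, hlen, show (0 : ℝ) < 1 / n by positivity]
  refine (Finset.sum_le_sum fun j _ => hterm j).trans (le_of_eq ?_)
  simp
  field_simp

open Filter Topology in
lemma tendsto_riemannSum {f : ℝ → ℝ} (hf : ContinuousOn f (Icc 0 1)) :
    Tendsto (fun n : ℕ => ∑ j : Fin n, (1 / n : ℝ) * f (j / n)) atTop
      (𝓝 (∫ x in (0 : ℝ)..1, f x)) := by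
  rw [Metric.tendsto_atTop]
  intro ε hε
  obtain ⟨δ, hδ, h⟩ := Metric.uniformContinuousOn_iff.1
    (isCompact_Icc.uniformContinuousOn_of_continuous hf) (ε / 2) (half_pos hε)
  obtain ⟨N, hN⟩ := exists_nat_one_div_lt hδ
  refine ⟨N + 1, fun n hn => ?_⟩
  rw [Real.dist_eq]
  refine (abs_riemannSum_sub_integral_le hf (by lia) fun x hx y hy hxy => ?_).trans_lt
    (half_lt_self hε)
  refine (h x hx y hy (hxy.trans_lt (lt_of_le_of_lt ?_ hN))).le
  gcongr
  exact_mod_cast hn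

open Filter Topology in
lemma tendsto_riemannSum_riemannSum {F : ℝ → ℝ → ℝ} {C : ℝ}
    (h₁ : ∀ x x' y, |F x y - F x' y| ≤ C * |x - x'|)
    (h₂ : ∀ x y y', |F x y - F x y'| ≤ C * |y - y'|) :
    Tendsto (fun n : ℕ => ∑ j : Fin n, ∑ i : Fin n, (1 / n : ℝ) * (1 / n : ℝ) * F (j / n) (i / n))
      atTop (𝓝 (∫ x in (0 : ℝ)..1, ∫ y in (0 : ℝ)..1, F x y)) := by
  have hC : 0 ≤ C := by simpa using (abs_nonneg _).trans (h₁ 1 0 0)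
  have hcont : ∀ x, Continuous (F x) := fun x =>
    (LipschitzWith.of_dist_le_mul (K := ⟨C, hC⟩) fun y y' => h₂ x y y').continuous
  have hG : Continuous fun x => ∫ y in (0 : ℝ)..1, F x y := by
    refine (LipschitzWith.of_dist_le_mul (K := ⟨C, hC⟩) fun x x' => ?_).continuous
    rw [Real.dist_eq, ← intervalIntegral.integral_sub ((hcont x).intervalIntegrable _ _)
      ((hcont x').intervalIntegrable _ _)]
    have h := intervalIntegral.norm_integral_le_of_norm_le_const (C := C * |x - x'|)
      (f := fun y => F x y - F x' y) (a := 0) (b := 1) fun y _ => h₁ x x' y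
    rw [sub_zero, abs_one, mul_one] at h
    exact h
  have hlim := tendsto_riemannSum hG.continuousOn
  have herr : Tendsto (fun n : ℕ => C * (1 / n : ℝ)) atTop (𝓝 0) := by
    simpa using tendsto_one_div_atTop_nhds_zero_nat.const_mul C
  refine tendsto_of_tendsto_of_dist hlim (squeeze_zero' (.of_forall fun _ => dist_nonneg) ?_ herr)
  filter_upwards [eventually_ne_atTop 0] with n hn
  have hn0 : (0 : ℝ) < n := by positivity
  rw [Real.dist_eq, ← Finset.sum_sub_distrib]
  refine (Finset.abs_sum_le_sum_abs _ _).trans ?_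
  have hterm : ∀ j : Fin n, |(1 / n : ℝ) * (∫ y in (0 : ℝ)..1, F (j / n) y)
      - ∑ i : Fin n, (1 / n : ℝ) * (1 / n : ℝ) * F (j / n) (i / n)|
      ≤ (1 / n : ℝ) * (C * (1 / n)) := by
    intro j
    simp_rw [mul_assoc]
    rw [← Finset.mul_sum, ← mul_sub, abs_mul, abs_of_pos (by positivity : (0 : ℝ) < 1 / n),
      abs_sub_comm]
    gcongr
    exact abs_riemannSum_sub_integral_le (hcont _).continuousOn hn fun x _ y _ hxy =>
      (h₂ _ x y).trans (by gcongr)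
  refine (Finset.sum_le_sum fun j _ => hterm j).trans (le_of_eq ?_)
  simp
  field_simp

namespace IsBrownianMotion

variable {Ω : Type*} [MeasurableSpace Ω] {P : Measure Ω} {B : ℝ → Ω → ℝ}

lemma continuousOn_affine (hB : IsBrownianMotion P B) {p q : ℝ}
    (h : ∀ x ∈ Icc (0 : ℝ) 1, p + q * x ∈ Icc (0 : ℝ) 1) (ω : Ω) :
    ContinuousOn (fun x => B (p + q * x) ω) (Icc 0 1) :=
  (hB.2.1 ω).comp (f := fun x : ℝ => p + q * x) (by fun_prop) h

open Filter Topology in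
lemma measurable_integral_affine (hB : IsBrownianMotion P B) {p q : ℝ}
    (h : ∀ x ∈ Icc (0 : ℝ) 1, p + q * x ∈ Icc (0 : ℝ) 1) :
    Measurable fun ω => ∫ x in (0 : ℝ)..1, B (p + q * x) ω := by
  refine measurable_of_tendsto_metrizable
    (f := fun (n : ℕ) ω => ∑ j : Fin n, (1 / n : ℝ) * B (p + q * (j / n)) ω)
    (fun n => Finset.measurable_fun_sum _ fun j _ => (hB.1 _).const_mul _) ?_
  exact tendsto_pi_nhds.2 fun ω => tendsto_riemannSum (hB.continuousOn_affine h ω)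

open Filter Topology in
/-- Characteristic function of a linear combination of integrals of the Brownian motion along
affine reparametrizations. -/
lemma integral_cexp_sum_integral (hB : IsBrownianMotion P B) [IsFiniteMeasure P]
    {κ : Type*} [Fintype κ] {p q : κ → ℝ}
    (h : ∀ k, ∀ x ∈ Icc (0 : ℝ) 1, p k + q k * x ∈ Icc (0 : ℝ) 1) (a : κ → ℝ) :
    ∫ ω, Complex.exp (Complex.I * ((∑ k, a k * ∫ x in (0 : ℝ)..1, B (p k + q k * x) ω : ℝ) : ℂ)) ∂P
      = Complex.exp ((-(1 / 2) * ∑ k, ∑ l, a k * a l *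
          ∫ x in (0 : ℝ)..1, ∫ y in (0 : ℝ)..1, min (p k + q k * x) (p l + q l * y) : ℝ) : ℂ) := by
  have hL : Tendsto (fun n : ℕ => ∫ ω, Complex.exp (Complex.I *
      ((∑ k, a k * ∑ j : Fin n, (1 / n : ℝ) * B (p k + q k * (j / n)) ω : ℝ) : ℂ)) ∂P) atTop
      (𝓝 (∫ ω, Complex.exp (Complex.I *
        ((∑ k, a k * ∫ x in (0 : ℝ)..1, B (p k + q k * x) ω : ℝ) : ℂ)) ∂P)) := by
    refine tendsto_integral_of_dominated_convergence (fun _ => 1) (fun n => ?_)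
      (integrable_const _) (fun n => .of_forall fun ω => ?_) (.of_forall fun ω => ?_)
    · have := hB.1
      exact Measurable.aestronglyMeasurable (by fun_prop)
    · rw [Complex.norm_exp_I_mul_ofReal]
    · refine (Complex.continuous_exp.tendsto _).comp (Tendsto.const_mul _
        ((Complex.continuous_ofReal.tendsto _).comp ?_))
      exact tendsto_finsetSum _ fun k _ =>
        (tendsto_riemannSum (hB.continuousOn_affine (h k) ω)).const_mul _
  have hR : Tendsto (fun n : ℕ => Complex.exp ((-(1 / 2) * ∑ k, ∑ l, a k * a l *
      ∑ j : Fin n, ∑ i : Fin n, (1 / n : ℝ) * (1 / n : ℝ) *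
        min (p k + q k * (j / n)) (p l + q l * (i / n)) : ℝ) : ℂ)) atTop
      (𝓝 (Complex.exp ((-(1 / 2) * ∑ k, ∑ l, a k * a l *
          ∫ x in (0 : ℝ)..1, ∫ y in (0 : ℝ)..1,
            min (p k + q k * x) (p l + q l * y) : ℝ) : ℂ))) := by
    have hkl : ∀ k l, Tendsto (fun n : ℕ => ∑ j : Fin n, ∑ i : Fin n, (1 / n : ℝ) * (1 / n : ℝ) *
        min (p k + q k * (j / n)) (p l + q l * (i / n))) atTop (𝓝 (∫ x in (0 : ℝ)..1,
          ∫ y in (0 : ℝ)..1, min (p k + q k * x) (p l + q l * y))) := by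
      intro k l
      refine tendsto_riemannSum_riemannSum
        (F := fun x y => min (p k + q k * x) (p l + q l * y)) (C := max |q k| |q l|)
        (fun x x' y => ?_) (fun x y y' => ?_)
      · refine (abs_min_sub_min_le_max _ _ _ _).trans ?_
        rw [sub_self, abs_zero, max_eq_left (abs_nonneg _), add_sub_add_left_eq_sub, ← mul_sub,
          abs_mul]
        gcongr
        exact le_max_left _ _
      · refine (abs_min_sub_min_le_max _ _ _ _).trans ?_
        rw [sub_self, abs_zero, max_eq_right (abs_nonneg _), add_sub_add_left_eq_sub, ← mul_sub,
          abs_mul]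
        gcongr
        exact le_max_right _ _
    have hsum := tendsto_finsetSum Finset.univ fun k _ =>
      tendsto_finsetSum Finset.univ fun l _ => (hkl k l).const_mul (a k * a l)
    exact (Complex.continuous_exp.tendsto _).comp
      ((Complex.continuous_ofReal.tendsto _).comp (hsum.const_mul _))
  refine tendsto_nhds_unique hL (hR.congr fun n => ?_)
  have hmem : ∀ i : κ × Fin n, p i.1 + q i.1 * (i.2 / n) ∈ Icc (0 : ℝ) 1 := fun i =>
    h _ _ ⟨by positivity, div_le_one_of_le₀ (by exact_mod_cast i.2.2.le) (by positivity)⟩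
  have key := hB.integral_cexp_sum hmem fun i => a i.1 * (1 / n : ℝ)
  simp only [Fintype.sum_prod_type] at key
  simp only [Finset.mul_sum]
  convert key.symm using 2
  · congr 1
    rw [Finset.mul_sum]
    refine Finset.sum_congr rfl fun k _ => ?_
    rw [Finset.sum_comm, Finset.mul_sum]
    refine Finset.sum_congr rfl fun j _ => ?_
    rw [Finset.mul_sum]
    refine Finset.sum_congr rfl fun l _ => ?_
    rw [Finset.mul_sum]
    refine Finset.sum_congr rfl fun i _ => ?_
    ring
  · simp only [mul_assoc]

end IsBrownianMotion

lemma integral_min_right {s : ℝ} (hs : s ∈ Icc (0 : ℝ) 1) :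
    ∫ y in (0 : ℝ)..1, min s y = s - s ^ 2 / 2 := by
  have hc : Continuous fun y : ℝ => min s y := by fun_prop
  rw [← intervalIntegral.integral_add_adjacent_intervals (b := s)
    (hc.intervalIntegrable _ _) (hc.intervalIntegrable _ _)]
  have h1 : ∫ y in (0 : ℝ)..s, min s y = ∫ y in (0 : ℝ)..s, y :=
    intervalIntegral.integral_congr fun y hy => by
      rw [uIcc_of_le hs.1] at hy
      exact min_eq_right hy.2
  have h2 : ∫ y in s..1, min s y = ∫ y in s..1, s :=
    intervalIntegral.integral_congr fun y hy => by
      rw [uIcc_of_le hs.2] at hy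
      exact min_eq_left hy.1
  rw [h1, h2]
  simp
  ring

lemma integral_min_half_mul {s : ℝ} (hs : s ∈ Icc (0 : ℝ) 1) :
    ∫ y in (0 : ℝ)..1, min s (1 / 2 * y) = if s ≤ 1 / 2 then s - s ^ 2 else 1 / 4 := by
  split_ifs with h
  · have : ∀ y : ℝ, min s (1 / 2 * y) = 1 / 2 * min (2 * s) y := fun y => by
      rw [mul_min_of_nonneg _ _ (by norm_num)]
      congr 1
      ring
    simp_rw [this]
    rw [intervalIntegral.integral_const_mul,
      integral_min_right ⟨by linarith [hs.1], by linarith⟩]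
    ring
  · have : ∫ y in (0 : ℝ)..1, min s (1 / 2 * y) = ∫ y in (0 : ℝ)..1, 1 / 2 * y :=
      intervalIntegral.integral_congr fun y hy => by
        rw [uIcc_of_le zero_le_one] at hy
        exact min_eq_right (by linarith [hy.2])
    rw [this, intervalIntegral.integral_const_mul]
    simp
    norm_num

lemma integral_integral_min :
    ∫ x in (0 : ℝ)..1, ∫ y in (0 : ℝ)..1, min x y = 1 / 3 := by
  have : ∫ x in (0 : ℝ)..1, ∫ y in (0 : ℝ)..1, min x y = ∫ x in (0 : ℝ)..1, (x - x ^ 2 / 2) :=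
    intervalIntegral.integral_congr fun x hx => by
      rw [uIcc_of_le zero_le_one] at hx
      exact integral_min_right hx
  rw [this, intervalIntegral.integral_sub (by simp) (by simp)]
  simp
  norm_num

lemma integral_integral_min_half_left :
    ∫ x in (0 : ℝ)..1, ∫ y in (0 : ℝ)..1, min (1 / 2 * x) y = 5 / 24 := by
  have : ∫ x in (0 : ℝ)..1, ∫ y in (0 : ℝ)..1, min (1 / 2 * x) y
      = ∫ x in (0 : ℝ)..1, (1 / 2 * x - x ^ 2 / 8) :=
    intervalIntegral.integral_congr fun x hx => by
      rw [uIcc_of_le zero_le_one] at hx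
      refine (integral_min_right ⟨by linarith [hx.1], by linarith [hx.2]⟩).trans ?_
      ring
  rw [this, intervalIntegral.integral_sub (Continuous.intervalIntegrable (by fun_prop) _ _)
    (by simp), intervalIntegral.integral_const_mul]
  simp
  norm_num

lemma integral_integral_min_half_right :
    ∫ x in (0 : ℝ)..1, ∫ y in (0 : ℝ)..1, min x (1 / 2 * y) = 5 / 24 := by
  rw [intervalIntegral_intervalIntegral_swap, ← integral_integral_min_half_left]
  · simp_rw [min_comm]
  · have hF : Continuous (Function.uncurry fun x y : ℝ => min x (1 / 2 * y)) := by fun_prop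
    exact (hF.continuousOn.integrableOn_compact (isCompact_uIcc.prod isCompact_uIcc)).mono_set
      (prod_mono uIoc_subset_uIcc uIoc_subset_uIcc)

lemma integral_integral_min_half_half :
    ∫ x in (0 : ℝ)..1, ∫ y in (0 : ℝ)..1, min (1 / 2 * x) (1 / 2 * y) = 1 / 6 := by
  have : ∀ x y : ℝ, min (1 / 2 * x) (1 / 2 * y) = 1 / 2 * min x y := fun x y =>
    (mul_min_of_nonneg _ _ (by norm_num)).symm
  simp_rw [this, intervalIntegral.integral_const_mul]
  rw [integral_integral_min]
  norm_num

namespace IsBrownianMotion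

variable {Ω : Type*} [MeasurableSpace Ω] {P : Measure Ω} {B : ℝ → Ω → ℝ}

lemma integral_half_add (hB : IsBrownianMotion P B) (ω : Ω) :
    ∫ r in (0 : ℝ)..(1 / 2), (B r ω + B (1 / 2) ω)
      = 1 / 2 * B (1 / 2) ω + 1 / 2 * ∫ x in (0 : ℝ)..1, B (1 / 2 * x) ω := by
  have hint : IntervalIntegrable (fun r => B r ω) volume 0 (1 / 2) := by
    refine ((hB.2.1 ω).mono ?_).intervalIntegrable
    rw [uIcc_of_le (by norm_num)]
    exact Icc_subset_Icc_right (by norm_num)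
  rw [intervalIntegral.integral_add hint (by simp),
    intervalIntegral.integral_comp_mul_left (fun r => B r ω) (by norm_num)]
  simp
  ring

lemma measurable_integral_one (hB : IsBrownianMotion P B) :
    Measurable fun ω => ∫ r in (0 : ℝ)..1, B r ω := by
  simpa using hB.measurable_integral_affine (p := 0) (q := 1) (by simp)

lemma measurable_integral_half_add (hB : IsBrownianMotion P B) :
    Measurable fun ω => ∫ r in (0 : ℝ)..(1 / 2), (B r ω + B (1 / 2) ω) := by
  simp_rw [hB.integral_half_add]
  have h := hB.measurable_integral_affine (p := 0) (q := 1 / 2)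
    fun x hx => ⟨by linarith [hx.1], by linarith [hx.2]⟩
  simp only [zero_add] at h
  exact ((hB.1 _).const_mul _).add (h.const_mul _)

/-- Joint characteristic function of the Brownian motion, of `∫₀^{1/2} (B_r + B_{1/2}) dr` and of
`∫₀¹ B_r dr`. -/
lemma integral_cexp_sum_half_one (hB : IsBrownianMotion P B) [IsFiniteMeasure P]
    {κ : Type*} [Fintype κ] {t : κ → ℝ} (ht : ∀ k, t k ∈ Icc (0 : ℝ) 1) (a : κ → ℝ) (α β : ℝ) :
    ∫ ω, Complex.exp (Complex.I * ((∑ k, a k * B (t k) ω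
        + α * (∫ r in (0 : ℝ)..(1 / 2), (B r ω + B (1 / 2) ω))
        + β * (∫ r in (0 : ℝ)..1, B r ω) : ℝ) : ℂ)) ∂P
      = Complex.exp ((-(1 / 2) * (∑ k, ∑ l, a k * a l * min (t k) (t l)
          + 2 * α * ∑ k, a k * (if t k ≤ 1 / 2 then t k - t k ^ 2 / 2 else 3 / 8)
          + 2 * β * ∑ k, a k * (t k - t k ^ 2 / 2)
          + 7 / 24 * (α ^ 2 + 2 * α * β) + β ^ 2 / 3) : ℝ) : ℂ) := by
  have key := hB.integral_cexp_sum_integral (κ := κ ⊕ Fin 3)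
    (p := Sum.elim t ![1 / 2, 0, 0]) (q := Sum.elim 0 ![0, 1 / 2, 1]) (fun k x hx => by
      rcases k with k | k
      · simpa using ht k
      · fin_cases k
        · norm_num
        · simp only [Sum.elim_inr]
          exact ⟨by simpa using hx.1, by norm_num; linarith [hx.2]⟩
        · simpa using hx) (Sum.elim a ![α / 2, α / 2, β])
  have one_right : ∀ s ∈ Icc (0 : ℝ) 1, ∫ y in (0 : ℝ)..1, min s y = s - s ^ 2 / 2 :=
    fun s hs => integral_min_right hs
  have one_left : ∀ s ∈ Icc (0 : ℝ) 1, ∫ y in (0 : ℝ)..1, min y s = s - s ^ 2 / 2 :=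
    fun s hs => by simp_rw [min_comm _ s, integral_min_right hs]
  have half_right : ∀ s ∈ Icc (0 : ℝ) 1, ∫ y in (0 : ℝ)..1, min s (1 / 2 * y)
      = if s ≤ 1 / 2 then s - s ^ 2 else 1 / 4 := fun s hs => integral_min_half_mul hs
  have half_left : ∀ s ∈ Icc (0 : ℝ) 1, ∫ y in (0 : ℝ)..1, min (1 / 2 * y) s
      = if s ≤ 1 / 2 then s - s ^ 2 else 1 / 4 := fun s hs => by
    simp_rw [min_comm _ s, integral_min_half_mul hs]
  have hmem : (1 / 2 : ℝ) ∈ Icc (0 : ℝ) 1 := by norm_num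
  simp only [Fintype.sum_sum_type, Fin.sum_univ_three, Sum.elim_inl, Sum.elim_inr,
    Matrix.cons_val_zero, Matrix.cons_val_one, Matrix.cons_val,
    Pi.zero_apply, zero_mul, one_mul, zero_add, add_zero, intervalIntegral.integral_const,
    sub_zero, one_smul, integral_integral_min, integral_integral_min_half_left,
    integral_integral_min_half_right, integral_integral_min_half_half,
    one_right _ (ht _), one_left _ (ht _), half_right _ (ht _), half_left _ (ht _),
    one_right _ hmem, one_left _ hmem, half_right _ hmem, half_left _ hmem] at key
  convert key using 4
  · rw [hB.integral_half_add]
    push_cast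
    ring
  · have hA : ∀ k, a k * (if t k ≤ 1 / 2 then t k - t k ^ 2 / 2 else 3 / 8)
        = 1 / 2 * (a k * min (t k) (1 / 2)
          + a k * (if t k ≤ 1 / 2 then t k - t k ^ 2 else 1 / 4)) := fun k => by
      split_ifs with h
      · rw [min_eq_left h]; ring
      · rw [min_eq_right (not_le.1 h).le]; ring
    have hz : ∀ k (z m : ℝ), a k * z * m = z * (a k * m) := fun k z m => by ring
    simp only [hA, min_comm (1 / 2) (t _), hz, mul_assoc _ (a _)]
    simp only [Finset.sum_add_distrib, ← Finset.mul_sum, min_self, le_refl, if_true]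
    ring

end IsBrownianMotion

lemma integral_gaussianReal_cexp_quadratic (b d : ℂ) :
    ∫ y : ℝ, Complex.exp (-(7 / 48) * (y : ℂ) ^ 2 + b * y + d) ∂(gaussianReal 0 24)
      = ((√8)⁻¹ : ℝ) * Complex.exp (d + 3 / 2 * b ^ 2) := by
  rw [integral_gaussianReal_eq_integral_smul (by norm_num)]
  have h1 : ∀ y : ℝ, gaussianPDFReal 0 24 y • Complex.exp (-(7 / 48) * (y : ℂ) ^ 2 + b * y + d)
      = ((√(2 * Real.pi * 24))⁻¹ : ℝ) * Complex.exp (-(1 / 6) * (y : ℂ) ^ 2 + b * y + d) := fun y => by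
    rw [gaussianPDFReal, Complex.real_smul, Complex.ofReal_mul, mul_assoc, Complex.ofReal_exp,
      ← Complex.exp_add]
    push_cast
    congr 2
    ring
  simp_rw [h1]
  rw [integral_const_mul, integral_cexp_quadratic (by norm_num), ← mul_assoc]
  congr 1
  · have h2 : ((Real.pi : ℂ) / -(-(1 / 6))) = ((6 * Real.pi : ℝ) : ℂ) := by push_cast; ring
    have h3 : ((1 / 2 : ℂ)) = ((1 / 2 : ℝ) : ℂ) := by push_cast; rfl
    rw [h2, h3, ← Complex.ofReal_cpow (by positivity), ← Real.sqrt_eq_rpow, ← Complex.ofReal_mul,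
      show 2 * Real.pi * 24 = 8 * (6 * Real.pi) by ring, Real.sqrt_mul (by norm_num)]
    congr 1
    have : √(6 * Real.pi) ≠ 0 := by positivity
    field_simp
  · congr 1
    ring

lemma integral_cexp_mul_exp_sq {Ω : Type*} [MeasurableSpace Ω] {P : Measure Ω}
    [IsFiniteMeasure P] {Z A : Ω → ℝ} (hZ : Measurable Z) (hA : Measurable A) {V C : ℝ}
    (h : ∀ y : ℝ, ∫ ω, Complex.exp (Complex.I * ((Z ω + y * A ω : ℝ) : ℂ)) ∂P
      = Complex.exp ((-(1 / 2) * (V + 2 * y * C + 7 / 24 * y ^ 2) : ℝ) : ℂ)) (c : ℝ) :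
    ∫ ω, Complex.exp (Complex.I * (Z ω : ℂ)) *
        ((√8 * Real.exp (-12 * (A ω - c) ^ 2 + 3 / 2 * c ^ 2) : ℝ) : ℂ) ∂P
      = Complex.exp (-(1 / 2) * V + 3 / 2 * C ^ 2 + 3 * Complex.I * c * C) := by
  have hchar : ∀ u : ℝ, ((Real.exp (-12 * u ^ 2) : ℝ) : ℂ)
      = ∫ y : ℝ, Complex.exp (Complex.I * ((y * u : ℝ) : ℂ)) ∂(gaussianReal 0 24) := fun u => by
    have h1 := charFun_gaussianReal (μ := 0) (v := 24) u
    rw [charFun_apply_real] at h1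
    convert h1.symm using 2
    · push_cast
      congr 1
      ring
    · ext y
      push_cast
      congr 1
      ring
  have hfub : ∫ ω, Complex.exp (Complex.I * (Z ω : ℂ)) *
        ((Real.exp (-12 * (A ω - c) ^ 2) : ℝ) : ℂ) ∂P
      = ((√8)⁻¹ : ℝ) * Complex.exp (-(1 / 2) * V + 3 / 2 * (-(C + Complex.I * c)) ^ 2) := by
    have h1 : ∀ ω, Complex.exp (Complex.I * (Z ω : ℂ)) *
        ((Real.exp (-12 * (A ω - c) ^ 2) : ℝ) : ℂ)
        = ∫ y : ℝ, Complex.exp (Complex.I * ((Z ω + y * (A ω - c) : ℝ) : ℂ))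
          ∂(gaussianReal 0 24) := fun ω => by
      rw [hchar, ← integral_const_mul]
      congr 1
      ext y
      rw [← Complex.exp_add]
      push_cast
      congr 1
      ring
    simp_rw [h1]
    rw [integral_integral_swap]
    · rw [← integral_gaussianReal_cexp_quadratic]
      congr 1
      ext y
      have h2 : ∀ ω, Complex.exp (Complex.I * ((Z ω + y * (A ω - c) : ℝ) : ℂ))
          = Complex.exp (-(Complex.I * (y * c))) *
            Complex.exp (Complex.I * ((Z ω + y * A ω : ℝ) : ℂ)) := fun ω => by
        rw [← Complex.exp_add]
        push_cast
        congr 1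
        ring
      simp_rw [h2]
      rw [integral_const_mul, h, ← Complex.exp_add]
      push_cast
      congr 1
      ring
    · refine Integrable.of_bound (C := 1) (Measurable.aestronglyMeasurable ?_)
        (.of_forall fun x => ?_)
      · unfold Function.uncurry
        fun_prop
      · rw [Function.uncurry, Complex.norm_exp_I_mul_ofReal]
  have h3 : ∀ ω, Complex.exp (Complex.I * (Z ω : ℂ)) *
        ((√8 * Real.exp (-12 * (A ω - c) ^ 2 + 3 / 2 * c ^ 2) : ℝ) : ℂ)
      = ((√8 : ℝ) * Complex.exp (3 / 2 * c ^ 2)) * (Complex.exp (Complex.I * (Z ω : ℂ)) *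
        ((Real.exp (-12 * (A ω - c) ^ 2) : ℝ) : ℂ)) := fun ω => by
    rw [Real.exp_add]
    push_cast
    ring
  simp_rw [h3]
  rw [integral_const_mul, hfub]
  have h8 : ((√8 : ℝ) : ℂ) * ((√8)⁻¹ : ℝ) = 1 := by
    rw [← Complex.ofReal_mul, mul_inv_cancel₀ (by positivity), Complex.ofReal_one]
  rw [mul_mul_mul_comm, h8, one_mul, ← Complex.exp_add]
  congr 1
  linear_combination (3 / 2 * (c : ℂ) ^ 2) * Complex.I_sq

namespace IsBrownianMotion

variable {Ω : Type*} [MeasurableSpace Ω] {P : Measure Ω} {B : ℝ → Ω → ℝ}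

lemma integral_cexp_sum_conditioned (hB : IsBrownianMotion P B) [IsFiniteMeasure P]
    {κ : Type*} [Fintype κ] {t : κ → ℝ} (ht : ∀ k, t k ∈ Icc (0 : ℝ) 1) (a : κ → ℝ) (c : ℝ) :
    ∫ ω, Complex.exp (Complex.I * ((∑ k, a k * (B (t k) ω
        + (3 / 2) * t k * (2 - t k) * (c - ∫ r in (0 : ℝ)..1, B r ω)) : ℝ) : ℂ)) ∂P
      = Complex.exp (-(1 / 2) * (∑ k, ∑ l, a k * a l * min (t k) (t l) : ℝ)
          + 3 / 2 * (∑ k, a k * (t k - t k ^ 2 / 2) : ℝ) ^ 2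
          + 3 * Complex.I * c * (∑ k, a k * (t k - t k ^ 2 / 2) : ℝ)) := by
  have key := hB.integral_cexp_sum_half_one ht a 0 (-3 * ∑ k, a k * (t k - t k ^ 2 / 2))
  set H := ∑ k, a k * (t k - t k ^ 2 / 2) with hH
  set V := ∑ k, ∑ l, a k * a l * min (t k) (t l)
  have h1 : ∀ ω, ∑ k, a k * (B (t k) ω
        + (3 / 2) * t k * (2 - t k) * (c - ∫ r in (0 : ℝ)..1, B r ω))
      = 3 * c * H + (∑ k, a k * B (t k) ω
        + 0 * (∫ r in (0 : ℝ)..(1 / 2), (B r ω + B (1 / 2) ω))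
        + -3 * H * (∫ r in (0 : ℝ)..1, B r ω)) := fun ω => by
    have : ∑ k, a k * ((3 / 2) * t k * (2 - t k) * (c - ∫ r in (0 : ℝ)..1, B r ω))
        = H * (3 * (c - ∫ r in (0 : ℝ)..1, B r ω)) := by
      rw [hH, Finset.sum_mul]
      exact Finset.sum_congr rfl fun k _ => by ring
    simp only [mul_add, Finset.sum_add_distrib, this]
    ring
  simp_rw [h1]
  have h2 : ∀ x y : ℝ, Complex.exp (Complex.I * ((x + y : ℝ) : ℂ))
      = Complex.exp (Complex.I * x) * Complex.exp (Complex.I * y) := fun x y => by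
    rw [Complex.ofReal_add, mul_add, Complex.exp_add]
  simp_rw [h2 (3 * c * H)]
  rw [integral_const_mul, key, ← Complex.exp_add]
  push_cast
  congr 1
  ring

/-- Weighted characteristic function of the process whose second half is a bridge. -/
lemma integral_cexp_sum_mul_weight (hB : IsBrownianMotion P B) [IsFiniteMeasure P]
    {κ : Type*} [Fintype κ] {t : κ → ℝ} (ht : ∀ k, t k ∈ Icc (0 : ℝ) 1) (a : κ → ℝ) (c : ℝ) :
    ∫ ω, Complex.exp (Complex.I * ((∑ k, a k * (B (t k) ω
        + (if t k ∈ Icc (1 / 2 : ℝ) 1 then 12 * t k * (2 - t k) - 9 else 0)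
          * (c - ∫ r in (0 : ℝ)..1, B r ω)) : ℝ) : ℂ)) *
        ((√8 * Real.exp (-12 * ((∫ r in (0 : ℝ)..(1 / 2), (B r ω + B (1 / 2) ω)) - c) ^ 2
          + 3 / 2 * c ^ 2) : ℝ) : ℂ) ∂P
      = Complex.exp (-(1 / 2) * (∑ k, ∑ l, a k * a l * min (t k) (t l) : ℝ)
          + 3 / 2 * (∑ k, a k * (t k - t k ^ 2 / 2) : ℝ) ^ 2
          + 3 * Complex.I * c * (∑ k, a k * (t k - t k ^ 2 / 2) : ℝ)) := by
  set g : κ → ℝ := fun k => if t k ∈ Icc (1 / 2 : ℝ) 1 then 12 * t k * (2 - t k) - 9 else 0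
    with hg
  have hcov : ∑ k, a k * (if t k ≤ 1 / 2 then t k - t k ^ 2 / 2 else 3 / 8)
      = ∑ k, a k * (t k - t k ^ 2 / 2) - (∑ k, a k * g k) / 24 := by
    rw [Finset.sum_div, ← Finset.sum_sub_distrib]
    refine Finset.sum_congr rfl fun k _ => ?_
    simp only [hg, mem_Icc, (ht k).2, and_true]
    rcases lt_trichotomy (t k) (1 / 2) with h | h | h
    · rw [if_pos h.le, if_neg h.not_ge]
      ring
    · rw [h]
      norm_num
    · rw [if_neg h.not_ge, if_pos h.le]
      ring
  set G := ∑ k, a k * g k with hG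
  have hB1 := hB.measurable_integral_one
  have hBt := hB.1
  have key := integral_cexp_mul_exp_sq (P := P)
    (Z := fun ω => ∑ k, a k * B (t k) ω + -G * ∫ r in (0 : ℝ)..1, B r ω)
    (V := ∑ k, ∑ l, a k * a l * min (t k) (t l) - 2 * G * ∑ k, a k * (t k - t k ^ 2 / 2)
      + G ^ 2 / 3)
    (C := ∑ k, a k * (t k - t k ^ 2 / 2) - G / 3) (by fun_prop)
    hB.measurable_integral_half_add (fun y => by
      convert hB.integral_cexp_sum_half_one ht a y (-G) using 1
      · congr 1
        ext ω
        congr 3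
        ring
      · congr 2
        rw [hcov]
        ring) c
  set H := ∑ k, a k * (t k - t k ^ 2 / 2)
  set V := ∑ k, ∑ l, a k * a l * min (t k) (t l)
  have h1 : ∀ ω, Complex.exp (Complex.I * ((∑ k, a k * (B (t k) ω
        + g k * (c - ∫ r in (0 : ℝ)..1, B r ω)) : ℝ) : ℂ))
      = Complex.exp (Complex.I * (c * G)) * Complex.exp (Complex.I *
        ((∑ k, a k * B (t k) ω + -G * ∫ r in (0 : ℝ)..1, B r ω : ℝ) : ℂ)) := fun ω => by
    have : ∑ k, a k * (g k * (c - ∫ r in (0 : ℝ)..1, B r ω))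
        = G * (c - ∫ r in (0 : ℝ)..1, B r ω) := by
      rw [hG, Finset.sum_mul]
      exact Finset.sum_congr rfl fun k _ => by ring
    simp only [mul_add, Finset.sum_add_distrib, this]
    rw [← Complex.exp_add]
    push_cast
    congr 1
    ring
  have hg' : ∀ k, (if t k ∈ Icc (1 / 2 : ℝ) 1 then 12 * t k * (2 - t k) - 9 else 0) = g k :=
    fun _ => rfl
  simp only [hg', h1, mul_assoc (Complex.exp (Complex.I * (c * G)))]
  rw [integral_const_mul, key, ← Complex.exp_add]
  push_cast
  congr 1
  ring

end IsBrownianMotion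

/-- Finite measures on a product of copies of `ℝ` are determined by the characteristic functions
of their finite-dimensional marginals. -/
lemma ext_of_integral_cexp_sum {T : Type*} {μ ν : Measure (T → ℝ)} [IsFiniteMeasure μ]
    [IsFiniteMeasure ν]
    (h : ∀ (s : Finset T) (a : s → ℝ),
      ∫ x, Complex.exp (Complex.I * ((∑ k, a k * x k : ℝ) : ℂ)) ∂μ
        = ∫ x, Complex.exp (Complex.I * ((∑ k, a k * x k : ℝ) : ℂ)) ∂ν) :
    μ = ν := by
  classical
  refine IsProjectiveLimit.unique (P := fun s : Finset T => μ.map s.restrict) (fun _ => rfl)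
    fun s => ?_
  refine (Measure.ext_of_charFunDual ?_).symm
  ext L
  have hL : ∀ x : s → ℝ, L x = ∑ k, L (Pi.single k 1) * x k := fun x => by
    conv_lhs => rw [← Finset.univ_sum_single x]
    rw [map_sum]
    refine Finset.sum_congr rfl fun k _ => ?_
    rw [mul_comm, ← smul_eq_mul, ← map_smul, ← Pi.single_smul, smul_eq_mul, mul_one]
  have hm : ∀ ρ : Measure (T → ℝ), charFunDual (ρ.map s.restrict) L
      = ∫ x, Complex.exp (Complex.I * ((∑ k : s, L (Pi.single k 1) * x k : ℝ) : ℂ)) ∂ρ := fun ρ => by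
    rw [charFunDual_apply, integral_map (by fun_prop)
      (Measurable.aestronglyMeasurable (by fun_prop))]
    congr 1
    ext x
    rw [hL, mul_comm]
    rfl
  rw [hm, hm, h]

/-- Absolute continuity formula for the conditioned Brownian motion:
`E[Φ(B^c)] = E[Φ(S) ρ(S)]`, where `S = B` on `[0,1/2]`,
`S_t = B_t + (12t(2-t)-9)(c - ∫₀¹ B)` on `[1/2,1]`, and
`ρ(ω) = √8 exp(-12(∫₀^{1/2}(ω_r + ω_{1/2})dr - c)² + (3/2)c²)`. -/
theorem bm_conditioned_abs_continuity
    {Ω : Type*} [MeasurableSpace Ω] (P : Measure Ω) [IsProbabilityMeasure P]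
    (B : ℝ → Ω → ℝ) (hB : IsBrownianMotion P B)
    (c : ℝ) (Bc : ℝ → Ω → ℝ)
    (hBc : ∀ t ω, Bc t ω
      = B t ω + (3/2) * t * (2 - t) * (c - ∫ r in (0:ℝ)..1, B r ω))
    (S : ℝ → Ω → ℝ)
    (hS : ∀ t ω, S t ω =
      if t ∈ Icc (1/2 : ℝ) 1
        then B t ω + (12 * t * (2 - t) - 9) * (c - ∫ r in (0:ℝ)..1, B r ω)
        else B t ω)
    (Φ : (Icc (0:ℝ) 1 → ℝ) → ℝ) (hΦ : Measurable Φ) (hΦb : ∃ C, ∀ x, |Φ x| ≤ C) :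
    ∫ ω, Φ (fun t => Bc t.1 ω) ∂P
      = ∫ ω, Φ (fun t => S t.1 ω) *
          (Real.sqrt 8 *
            Real.exp (-12 *
              ((∫ r in (0:ℝ)..(1/2), (S r ω + S (1/2) ω)) - c) ^ 2
              + (3/2) * c ^ 2)) ∂P := by
  obtain ⟨hBm, -⟩ := id hB
  have hI := hB.measurable_integral_one
  have hA := hB.measurable_integral_half_add
  have hS' : ∀ t ω, S t ω = B t ω
      + (if t ∈ Icc (1 / 2 : ℝ) 1 then 12 * t * (2 - t) - 9 else 0)
        * (c - ∫ r in (0 : ℝ)..1, B r ω) := fun t ω => by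
    rw [hS]
    split_ifs <;> simp
  have hS_half : ∀ t ≤ 1 / 2, ∀ ω, S t ω = B t ω := fun t ht ω => by
    rw [hS']
    rcases ht.lt_or_eq with h | rfl
    · rw [if_neg fun hm => h.not_ge hm.1, zero_mul, add_zero]
    · norm_num
  have hSA : ∀ ω, ∫ r in (0 : ℝ)..(1 / 2), (S r ω + S (1 / 2) ω)
      = ∫ r in (0 : ℝ)..(1 / 2), (B r ω + B (1 / 2) ω) := fun ω =>
    intervalIntegral.integral_congr fun r hr => by
      rw [uIcc_of_le (by norm_num)] at hr
      rw [hS_half r hr.2, hS_half _ le_rfl]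
  simp_rw [hSA]
  set W : Ω → ℝ := fun ω => √8 * Real.exp (-12 *
    ((∫ r in (0 : ℝ)..(1 / 2), (B r ω + B (1 / 2) ω)) - c) ^ 2 + 3 / 2 * c ^ 2) with hW
  have hWm : Measurable W := by fun_prop
  have hW0 : ∀ ω, 0 ≤ W ω := fun ω => by positivity
  have hWint : Integrable W P := by
    refine Integrable.of_bound (C := √8 * Real.exp (3 / 2 * c ^ 2)) hWm.aestronglyMeasurable
      (.of_forall fun ω => ?_)
    rw [Real.norm_of_nonneg (hW0 ω)]
    simp only [hW]
    gcongr
    nlinarith [sq_nonneg ((∫ r in (0 : ℝ)..(1 / 2), (B r ω + B (1 / 2) ω)) - c)]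
  have hBcm : Measurable fun ω (t : Icc (0 : ℝ) 1) => Bc t.1 ω := by
    refine measurable_pi_lambda _ fun t => ?_
    simp_rw [hBc]
    fun_prop
  have hSm : Measurable fun ω (t : Icc (0 : ℝ) 1) => S t.1 ω := by
    refine measurable_pi_lambda _ fun t => ?_
    simp_rw [hS']
    fun_prop
  set Q := P.withDensity fun ω => ENNReal.ofReal (W ω) with hQ
  have : IsFiniteMeasure Q := isFiniteMeasure_withDensity_ofReal hWint.2
  have hQint : ∀ f : Ω → ℝ, ∫ ω, f ω ∂Q = ∫ ω, f ω * W ω ∂P := fun f => by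
    rw [hQ, integral_withDensity_eq_integral_toReal_smul (by fun_prop) (by simp)]
    congr 1
    ext ω
    rw [ENNReal.toReal_ofReal (hW0 ω), smul_eq_mul, mul_comm]
  have hQintC : ∀ f : Ω → ℂ, ∫ ω, f ω ∂Q = ∫ ω, f ω * (W ω : ℂ) ∂P := fun f => by
    rw [hQ, integral_withDensity_eq_integral_toReal_smul (by fun_prop) (by simp)]
    congr 1
    ext ω
    rw [ENNReal.toReal_ofReal (hW0 ω), Complex.real_smul, mul_comm]
  have hlaw : P.map (fun ω (t : Icc (0 : ℝ) 1) => Bc t.1 ω)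
      = Q.map (fun ω (t : Icc (0 : ℝ) 1) => S t.1 ω) := by
    refine ext_of_integral_cexp_sum fun s a => ?_
    rw [integral_map hBcm.aemeasurable (Measurable.aestronglyMeasurable (by fun_prop)),
      integral_map hSm.aemeasurable (Measurable.aestronglyMeasurable (by fun_prop)), hQintC]
    have ht : ∀ k : s, (k.1.1 : ℝ) ∈ Icc (0 : ℝ) 1 := fun k => k.1.2
    simp_rw [hBc, hS']
    rw [hB.integral_cexp_sum_conditioned ht, hB.integral_cexp_sum_mul_weight ht]
  rw [← hQint, ← integral_map (f := Φ) hBcm.aemeasurable hΦ.aestronglyMeasurable,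
    ← integral_map (f := Φ) hSm.aemeasurable hΦ.aestronglyMeasurable, hlaw]
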